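/- Let X be a set with exactly 5 elements. There is no 2-consensus method on X, defined on profiles of binary trees (a family of functions φ_Y^2 : RBP(Y)^2 → RP(Y), one for each nonempty Y ⊆ X), that is regular and extension stable on binary trees. -/

import Mathlib

open Set

variable {α : Type*}

/-- `T` is the hierarchy of clusters of a rooted phylogenetic tree on the taxon set `X`:
a family of nonempty subsets of `X` containing `X` itself and all singletons, in which
any two members intersect trivially (`A ∩ B ∈ {∅, A, B}`). -/
def IsHierarchy (X : Set α) (T : Set (Set α)) : Prop :=
  (∀ C ∈ T, C ⊆ X ∧ C.Nonempty) ∧ X ∈ T ∧ (∀ x ∈ X, ({x} : Set α) ∈ T) ∧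
    ∀ A ∈ T, ∀ B ∈ T, A ∩ B = ∅ ∨ A ∩ B = A ∨ A ∩ B = B

/-- `RP X`: rooted phylogenetic trees on `X`, modeled as their hierarchies of clusters. -/
def RP (X : Set α) : Set (Set (Set α)) := {T | IsHierarchy X T}

/-- Restriction `T|_Y` of a tree to a subset `Y` of the taxa:
`T|_Y = {C ∩ Y : C ∈ T, C ∩ Y ≠ ∅}`. -/
def restrictTree (Y : Set α) (T : Set (Set α)) : Set (Set α) :=
  {D | ∃ C ∈ T, D = C ∩ Y ∧ (C ∩ Y).Nonempty}

/-- A tree is binary iff it is maximal in `(RP X, ⊆)`. -/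
def IsBinary (X : Set α) (T : Set (Set α)) : Prop :=
  T ∈ RP X ∧ ∀ T' ∈ RP X, T ⊆ T' → T' = T

/-- `RBP X`: rooted binary phylogenetic trees on `X`. -/
def RBP (X : Set α) : Set (Set (Set α)) := {T | IsBinary X T}

/-- Relabeling a tree along a map `σ`: `σ·T = {σ(C) : C ∈ T}`. -/
def mapTree (σ : α → α) (T : Set (Set α)) : Set (Set α) := (Set.image σ) '' T

namespace CatTree

/-- underlying set of a list -/
def LS (l : List α) : Set α := {t | t ∈ l}

/-- caterpillar tree of a list (first entries near the root) -/
def cat : List α → Set (Set α)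
  | [] => ∅
  | x :: l => insert (LS (x :: l)) (insert {x} (cat l))

theorem LS_cons (x : α) (l : List α) : LS (x :: l) = insert x (LS l) := by
  ext t; simp [LS]

theorem LS_nil : LS ([] : List α) = ∅ := by
  ext t; simp [LS]

theorem LS_map (σ : α → α) (l : List α) : σ '' LS l = LS (l.map σ) := by
  ext t; simp [LS]

theorem map_cat (σ : α → α) (l : List α) : mapTree σ (cat l) = cat (l.map σ) := by
  induction l with
  | nil => simp [cat, mapTree]
  | cons x l ih =>
    unfold mapTree at ih ⊢
    simp only [cat, List.map_cons, Set.image_insert_eq, ih, LS_map, Set.image_singleton]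

theorem restrict_insert_pos (Y C : Set α) (T : Set (Set α)) (h : (C ∩ Y).Nonempty) :
    restrictTree Y (insert C T) = insert (C ∩ Y) (restrictTree Y T) := by
  ext D
  constructor
  · rintro ⟨E, hE | hE, h1, h2⟩
    · subst hE; exact Or.inl h1
    · exact Or.inr ⟨E, hE, h1, h2⟩
  · rintro (hD | ⟨E, hE, h1, h2⟩)
    · exact ⟨C, Or.inl rfl, hD, h⟩
    · exact ⟨E, Or.inr hE, h1, h2⟩

theorem restrict_insert_neg (Y C : Set α) (T : Set (Set α)) (h : C ∩ Y = ∅) :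
    restrictTree Y (insert C T) = restrictTree Y T := by
  ext D
  constructor
  · rintro ⟨E, hE | hE, h1, h2⟩
    · subst hE; rw [h] at h2; exact absurd h2 (by simp)
    · exact ⟨E, hE, h1, h2⟩
  · rintro ⟨E, hE, h1, h2⟩
    exact ⟨E, Or.inr hE, h1, h2⟩

theorem LS_mem_cat (l : List α) (h : l ≠ []) : LS l ∈ cat l := by
  cases l with
  | nil => exact absurd rfl h
  | cons x l => exact Or.inl rfl

open Classical in
theorem LS_filter (Y : Set α) (l : List α) : LS l ∩ Y = LS (l.filter (· ∈ Y)) := by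
  ext t; simp [LS]

open Classical in
theorem restrict_cat (Y : Set α) (l : List α) :
    restrictTree Y (cat l) = cat (l.filter (· ∈ Y)) := by
  induction l with
  | nil => ext D; simp [cat, restrictTree]
  | cons x l ih =>
    by_cases hx : x ∈ Y
    · have h1 : ({x} : Set α) ∩ Y = {x} := by simpa using hx
      have e : (x :: l).filter (· ∈ Y) = x :: l.filter (· ∈ Y) := by simp [hx]
      rw [cat, restrict_insert_pos, restrict_insert_pos, ih, h1, LS_filter, e, cat]
      · rw [h1]; simp
      · exact ⟨x, by simp [LS], hx⟩
    · have h1 : ({x} : Set α) ∩ Y = ∅ := by simpa using hx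
      have e : (x :: l).filter (· ∈ Y) = l.filter (· ∈ Y) := by simp [hx]
      by_cases hn : l.filter (· ∈ Y) = []
      · rw [cat, restrict_insert_neg, restrict_insert_neg _ _ _ h1, ih, e]
        rw [LS_filter, e, hn, LS_nil]
      · rw [cat, restrict_insert_pos, restrict_insert_neg _ _ _ h1, ih, LS_filter, e]
        · exact Set.insert_eq_of_mem (LS_mem_cat _ hn)
        · rw [LS_filter, e]
          obtain ⟨y, hy⟩ := List.exists_mem_of_ne_nil _ hn
          exact ⟨y, hy⟩

theorem singleton_bin (x : α) : cat [x] ∈ RBP (LS [x]) := by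
  have e : LS [x] = {x} := by ext; simp [LS]
  have e2 : cat [x] = {{x}} := by simp [cat, e]
  rw [e, e2]
  refine ⟨⟨?_, ?_, ?_, ?_⟩, ?_⟩
  · rintro C rfl; simp
  · simp
  · simp
  · rintro A rfl B rfl; simp
  · rintro T' ⟨h1, h2, -, -⟩ _
    ext C
    constructor
    · intro hC
      obtain ⟨ha, hb⟩ := h1 C hC
      exact hb.subset_singleton_iff.1 ha
    · rintro rfl; exact h2

theorem cons_bin (x : α) (Y : Set α) (T : Set (Set α)) (hx : x ∉ Y) (hT : T ∈ RBP Y) :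
    insert (insert x Y) (insert {x} T) ∈ RBP (insert x Y) := by
  obtain ⟨⟨h1, h2, h3, h4⟩, hm⟩ := hT
  refine ⟨⟨?_, ?_, ?_, ?_⟩, ?_⟩
  · rintro C (rfl | rfl | hC)
    · simp
    · simp
    · exact ⟨(h1 C hC).1.trans (Set.subset_insert _ _), (h1 C hC).2⟩
  · exact Or.inl rfl
  · rintro y (rfl | hy)
    · exact Or.inr (Or.inl rfl)
    · exact Or.inr (Or.inr (h3 y hy))
  · have sub : ∀ C ∈ (insert {x} T : Set (Set α)), C ⊆ insert x Y := by
      rintro C (rfl | hC)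
      · simp
      · exact (h1 C hC).1.trans (Set.subset_insert _ _)
    have dis : ∀ C ∈ T, C ∩ {x} = ∅ := by
      intro C hC
      have := (h1 C hC).1
      simpa using fun h => hx (this h)
    rintro A (rfl | hA) B (rfl | hB)
    · simp
    · exact Or.inr (Or.inr (Set.inter_eq_right.2 (sub B hB)))
    · exact Or.inr (Or.inl (Set.inter_eq_left.2 (sub A hA)))
    · rcases hA with rfl | hA <;> rcases hB with rfl | hB
      · simp
      · left; rw [Set.inter_comm]; exact dis B hB
      · left; exact dis A hA
      · exact h4 A hA B hB
  · rintro T' ⟨k1, k2, k3, k4⟩ hsub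
    have hTT : T ⊆ T' := fun C hC => hsub (Or.inr (Or.inr hC))
    have key : {C | C ∈ T' ∧ C ⊆ Y} = T := by
      apply hm
      · refine ⟨fun C hC => ⟨hC.2, (k1 C hC.1).2⟩, ⟨hTT h2, subset_rfl⟩, ?_, ?_⟩
        · intro y hy
          exact ⟨hTT (h3 y hy), by simpa using hy⟩
        · intro A hA B hB
          exact k4 A hA.1 B hB.1
      · intro C hC
        exact ⟨hTT hC, (h1 C hC).1⟩
    refine Set.Subset.antisymm ?_ hsub
    intro C hC
    have hCs := (k1 C hC).1
    by_cases hxC : x ∈ C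
    · rcases k4 C hC Y (hTT h2) with h | h | h
      · right; left
        ext t
        constructor
        · intro ht
          rcases hCs ht with h' | h'
          · exact h'
          · have : t ∈ C ∩ Y := ⟨ht, h'⟩
            rw [h] at this; exact this.elim
        · rintro rfl; exact hxC
      · exact absurd (Set.inter_eq_left.1 h hxC) hx
      · left
        refine Set.Subset.antisymm hCs ?_
        exact Set.insert_subset hxC (Set.inter_eq_right.1 h)
    · right; right
      rw [← key]
      refine ⟨hC, fun t ht => ?_⟩
      rcases hCs ht with rfl | h'
      · exact absurd ht hxC
      · exact h'

theorem cat_bin (l : List α) (hne : l ≠ []) (hn : l.Nodup) : cat l ∈ RBP (LS l) := by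
  induction l with
  | nil => exact absurd rfl hne
  | cons x l ih =>
    by_cases h : l = []
    · subst h; exact singleton_bin x
    · rw [List.nodup_cons] at hn
      have := cons_bin x (LS l) (cat l) hn.1 (ih h hn.2)
      rw [← LS_cons] at this
      exact this

/-- two overlapping clusters are nested -/
theorem nested {X : Set α} {T : Set (Set α)} (h : T ∈ RP X) {A B : Set α} (hA : A ∈ T)
    (hB : B ∈ T) {p q r : α} (h1 : p ∈ A) (h2 : p ∈ B) (h3 : q ∈ A) (h4 : q ∉ B)
    (h5 : r ∈ B) (h6 : r ∉ A) : False := by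
  rcases h.2.2.2 A hA B hB with h | h | h
  · have : p ∈ A ∩ B := ⟨h1, h2⟩
    rw [h] at this; exact this
  · exact h4 (Set.inter_eq_left.1 h h3)
  · exact h6 (Set.inter_eq_right.1 h h5)

end CatTree

open CatTree

set_option maxHeartbeats 2000000

/-- For a taxon set `X` with exactly 5 elements, there is no 2-consensus
method on `X` defined on profiles of binary trees (a family `φ Y : RBP(Y)² → RP(Y)` for
nonempty `Y ⊆ X`) that is regular and extension stable on binary trees. -/
theorem no_regular_extension_stable_two_consensus_method_on_five_taxa
    (X : Set α) (hX5 : X.ncard = 5) :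
    ¬ ∃ φ : Set α → Set (Set α) → Set (Set α) → Set (Set α),
      -- `φ Y` maps pairs of binary trees on `Y` to trees on `Y`
      (∀ Y : Set α, Y.Nonempty → Y ⊆ X →
        ∀ T₁ ∈ RBP Y, ∀ T₂ ∈ RBP Y, φ Y T₁ T₂ ∈ RP Y) ∧
      -- unanimity
      (∀ Y : Set α, Y.Nonempty → Y ⊆ X → ∀ T ∈ RBP Y, φ Y T T = T) ∧
      -- anonymity
      (∀ Y : Set α, Y.Nonempty → Y ⊆ X →
        ∀ T₁ ∈ RBP Y, ∀ T₂ ∈ RBP Y, φ Y T₁ T₂ = φ Y T₂ T₁) ∧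
      -- neutrality: any bijection `σ : Y → Y'` between nonempty subsets of `X`
      (∀ Y : Set α, Y.Nonempty → Y ⊆ X →
        ∀ σ : α → α, Set.InjOn σ Y → σ '' Y ⊆ X →
          ∀ T₁ ∈ RBP Y, ∀ T₂ ∈ RBP Y,
            φ (σ '' Y) (mapTree σ T₁) (mapTree σ T₂) = mapTree σ (φ Y T₁ T₂)) ∧
      -- extension stability on binary trees
      (∀ Y X' : Set α, Y.Nonempty → Y ⊆ X' → X' ⊆ X →
        ∀ T₁ ∈ RBP X', ∀ T₂ ∈ RBP X',
          φ Y (restrictTree Y T₁) (restrictTree Y T₂) ⊆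
            restrictTree Y (φ X' T₁ T₂)) := by
  classical
  rintro ⟨φ, hR, hU, hA, hN, hE⟩
  obtain ⟨l, hl, hnd, hlen⟩ : ∃ l : List α, LS l = X ∧ l.Nodup ∧ l.length = 5 := by
    have hf : X.Finite := Set.finite_of_ncard_ne_zero (by omega)
    refine ⟨hf.toFinset.toList, ?_, Finset.nodup_toList _, ?_⟩
    · ext t; simp [LS]
    · rw [Finset.length_toList, ← Set.ncard_eq_toFinset_card X hf, hX5]
  obtain ⟨a, b, c, d, e, rfl⟩ : ∃ a b c d e, l = [a, b, c, d, e] := by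
    match l, hlen with
    | [a, b, c, d, e], _ => exact ⟨a, b, c, d, e, rfl⟩
  have hsubX : ∀ {m : List α}, (∀ t ∈ m, t ∈ [a, b, c, d, e]) → LS m ⊆ X := by
    intro m hm t ht
    rw [← hl]; exact hm t ht
  simp only [List.nodup_cons, List.mem_cons, List.not_mem_nil, or_false, not_or,
    List.nodup_nil, and_true, not_false_eq_true] at hnd
  obtain ⟨⟨hab, hac, had, hae⟩, ⟨hbc, hbd, hbe⟩, ⟨hcd, hce⟩, hde⟩ := hnd
  have hba := Ne.symm hab
  have hca := Ne.symm hac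
  have hda := Ne.symm had
  have hea := Ne.symm hae
  have hcb := Ne.symm hbc
  have hdb := Ne.symm hbd
  have heb := Ne.symm hbe
  have hdc := Ne.symm hcd
  have hec := Ne.symm hce
  have hed := Ne.symm hde
  have hne : ∀ (x : α) (m : List α), (LS (x :: m)).Nonempty := fun x m => ⟨x, by simp [LS]⟩
  have ext : ∀ m n k : List α, LS m = LS n → m ≠ [] → m.Nodup → n.Nodup → k ≠ [] →
      LS m ⊆ X → LS k ⊆ LS m →
      φ (LS k) (cat (m.filter (· ∈ LS k))) (cat (n.filter (· ∈ LS k))) ⊆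
        restrictTree (LS k) (φ (LS m) (cat m) (cat n)) := by
    intro m n k hmn hm hmd hnd hk hmX hkm
    have hn : n ≠ [] := by
      rintro rfl
      obtain ⟨x, hx⟩ := List.exists_mem_of_ne_nil _ hm
      have : x ∈ LS m := hx
      rw [hmn, LS_nil] at this; exact this
    obtain ⟨x, hx⟩ := List.exists_mem_of_ne_nil _ hk
    have := hE (LS k) (LS m) ⟨x, hx⟩ hkm hmX (cat m) (cat_bin m hm hmd) (cat n)
      (hmn ▸ cat_bin n hn hnd)
    rwa [restrict_cat, restrict_cat] at this
  -- four taxa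
  have four : ({b, d} : Set α) ∈ φ (LS [a, b, c, d]) (cat [a, b, c, d]) (cat [c, a, b, d]) ∨
      ({b, c, d} : Set α) ∈ φ (LS [a, b, c, d]) (cat [a, b, c, d]) (cat [c, a, b, d]) := by
    have hP : LS [a, b, c, d] = LS [c, a, b, d] := by ext t; simp [LS]; tauto
    have h := ext [a, b, c, d] [c, a, b, d] [a, b, d] hP (by simp) (by simp [*]) (by simp [*])
      (by simp) (hsubX (by simp)) (by intro t; simp [LS]; tauto)
    have hbin : cat [a, b, d] ∈ RBP (LS [a, b, d]) := cat_bin _ (by simp) (by simp [*])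
    have e1 : [a, b, c, d].filter (· ∈ LS [a, b, d]) = [a, b, d] := by simp [LS, *]
    have e2 : [c, a, b, d].filter (· ∈ LS [a, b, d]) = [a, b, d] := by simp [LS, *]
    rw [e1, e2, hU _ (hne _ _) (hsubX (by simp)) _ hbin] at h
    have hm : ({b, d} : Set α) ∈ cat [a, b, d] := by
      right; right; left
      ext t; simp [LS]
    obtain ⟨C, hC, hC2, -⟩ := h hm
    have hr := hR (LS [a, b, c, d]) (hne _ _) (hsubX (by simp)) (cat [a, b, c, d])
      (cat_bin _ (by simp) (by simp [*])) (cat [c, a, b, d])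
      (hP ▸ cat_bin _ (by simp) (by simp [*]))
    have hCs := (hr.1 C hC).1
    have q : ∀ t, (t ∈ ({b, d} : Set α)) ↔ t ∈ C ∩ LS [a, b, d] := fun t => by rw [hC2]
    have qa := q a
    have qb := q b
    have qd := q d
    simp [LS, hab, had] at qa qb qd
    have hC' : ∀ t ∈ C, t = a ∨ t = b ∨ t = c ∨ t = d := by
      intro t ht
      simpa [LS] using hCs ht
    by_cases hc : c ∈ C
    · right
      convert hC using 1
      ext t
      simp only [Set.mem_insert_iff, Set.mem_singleton_iff]
      constructor
      · rintro (rfl | rfl | rfl) <;> assumption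
      · intro ht
        rcases hC' t ht with rfl | h | h | h <;> tauto
    · left
      convert hC using 1
      ext t
      simp only [Set.mem_insert_iff, Set.mem_singleton_iff]
      constructor
      · rintro (rfl | rfl) <;> assumption
      · intro ht
        rcases hC' t ht with rfl | h | rfl | h <;> tauto
  -- transport by neutrality
  have trans : ∀ w x y z : α, [w, x, y, z].Nodup → (∀ t ∈ [w, x, y, z], t ∈ [a, b, c, d, e]) →
      ∃ σ : α → α, σ a = w ∧ σ b = x ∧ σ c = y ∧ σ d = z ∧
      φ (LS [w, x, y, z]) (cat [w, x, y, z]) (cat [y, w, x, z]) =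
        mapTree σ (φ (LS [a, b, c, d]) (cat [a, b, c, d]) (cat [c, a, b, d])) := by
    intro w x y z hw hwX
    let σ : α → α := fun t => if t = a then w else if t = b then x else if t = c then y else z
    have sa : σ a = w := by simp [σ]
    have sb : σ b = x := by simp [σ, *]
    have sc : σ c = y := by simp [σ, *]
    have sd : σ d = z := by simp [σ, *]
    have hP : LS [a, b, c, d] = LS [c, a, b, d] := by ext t; simp [LS]; tauto
    refine ⟨σ, sa, sb, sc, sd, ?_⟩
    have e0 : [a, b, c, d].map σ = [w, x, y, z] := by simp [sa, sb, sc, sd]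
    have e1 : [c, a, b, d].map σ = [y, w, x, z] := by simp [sa, sb, sc, sd]
    have h := hN (LS [a, b, c, d]) (hne _ _) (hsubX (by simp)) σ
      (fun s hs t ht hst => List.inj_on_of_nodup_map (by rw [e0]; exact hw) hs ht hst)
      (by rw [LS_map, e0]; exact hsubX hwX) (cat [a, b, c, d])
      (cat_bin _ (by simp) (by simp [*])) (cat [c, a, b, d])
      (hP ▸ cat_bin _ (by simp) (by simp [*]))
    rwa [LS_map, map_cat, map_cat, e0, e1] at h
  have hP : LS [a, b, c, e, d] = LS [c, e, a, b, d] := by ext t; simp [LS]; tauto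
  have h5X : LS [a, b, c, e, d] ⊆ X := hsubX (by simp)
  have b1 : cat [a, b, c, e, d] ∈ RBP (LS [a, b, c, e, d]) := cat_bin _ (by simp) (by simp [*])
  have b2 : cat [c, e, a, b, d] ∈ RBP (LS [a, b, c, e, d]) :=
    hP ▸ cat_bin _ (by simp) (by simp [*])
  have hr := hR _ (hne _ _) h5X _ b1 _ b2
  have an := hA _ (hne _ _) h5X _ b1 _ b2
  -- restriction of the main pair, in both orders
  have r1 := fun k hk hk2 => ext [a, b, c, e, d] [c, e, a, b, d] k hP (by simp) (by simp [*])
    (by simp [*]) hk h5X hk2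
  have r2 := fun k hk hk2 => ext [c, e, a, b, d] [a, b, c, e, d] k hP.symm (by simp)
    (by simp [*]) (by simp [*]) hk (hP ▸ h5X) hk2
  rw [← hP, ← an] at r2
  rcases four with h4 | h4
  · obtain ⟨σ, sa, sb, sc, sd, hs⟩ := trans a b e d (by simp [*]) (by simp)
    obtain ⟨τ, ta, tb, tc, td, ht⟩ := trans c e b d (by simp [*]) (by simp)
    have m1 : ({b, d} : Set α) ∈ φ (LS [a, b, e, d]) (cat [a, b, e, d]) (cat [e, a, b, d]) := by
      rw [hs]; exact ⟨_, h4, by simp [Set.image_insert_eq, sb, sd]⟩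
    have m2 : ({e, d} : Set α) ∈ φ (LS [c, e, b, d]) (cat [c, e, b, d]) (cat [b, c, e, d]) := by
      rw [ht]; exact ⟨_, h4, by simp [Set.image_insert_eq, tb, td]⟩
    have k1 := r1 [a, b, e, d] (by simp) (by intro t; simp [LS]; tauto)
    have k2 := r2 [c, e, b, d] (by simp) (by intro t; simp [LS]; tauto)
    have e1 : [a, b, c, e, d].filter (· ∈ LS [a, b, e, d]) = [a, b, e, d] := by simp [LS, *]
    have e2 : [c, e, a, b, d].filter (· ∈ LS [a, b, e, d]) = [e, a, b, d] := by simp [LS, *]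
    have e3 : [c, e, a, b, d].filter (· ∈ LS [c, e, b, d]) = [c, e, b, d] := by simp [LS, *]
    have e4 : [a, b, c, e, d].filter (· ∈ LS [c, e, b, d]) = [b, c, e, d] := by simp [LS, *]
    rw [e1, e2] at k1
    rw [e3, e4] at k2
    obtain ⟨C, hC, hC2, -⟩ := k1 m1
    obtain ⟨D, hD, hD2, -⟩ := k2 m2
    have qC : ∀ t, (t ∈ ({b, d} : Set α)) ↔ t ∈ C ∩ LS [a, b, e, d] := fun t => by rw [hC2]
    have qD : ∀ t, (t ∈ ({e, d} : Set α)) ↔ t ∈ D ∩ LS [c, e, b, d] := fun t => by rw [hD2]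
    have c1 := qC b
    have c2 := qC d
    have c3 := qC e
    have d1 := qD b
    have d2 := qD d
    have d3 := qD e
    simp [LS, heb, hed] at c1 c2 c3
    simp [LS, hbe, hbd] at d1 d2 d3
    exact nested hr hC hD c2 d2 c1 d1 d3 c3
  · obtain ⟨σ, sa, sb, sc, sd, hs⟩ := trans c e a d (by simp [*]) (by simp)
    have m2 : ({e, a, d} : Set α) ∈ φ (LS [c, e, a, d]) (cat [c, e, a, d]) (cat [a, c, e, d]) := by
      rw [hs]; exact ⟨_, h4, by simp [Set.image_insert_eq, sb, sc, sd]⟩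
    have k1 := r1 [a, b, c, d] (by simp) (by intro t; simp [LS]; tauto)
    have k2 := r2 [c, e, a, d] (by simp) (by intro t; simp [LS]; tauto)
    have e1 : [a, b, c, e, d].filter (· ∈ LS [a, b, c, d]) = [a, b, c, d] := by simp [LS, *]
    have e2 : [c, e, a, b, d].filter (· ∈ LS [a, b, c, d]) = [c, a, b, d] := by simp [LS, *]
    have e3 : [c, e, a, b, d].filter (· ∈ LS [c, e, a, d]) = [c, e, a, d] := by simp [LS, *]
    have e4 : [a, b, c, e, d].filter (· ∈ LS [c, e, a, d]) = [a, c, e, d] := by simp [LS, *]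
    rw [e1, e2] at k1
    rw [e3, e4] at k2
    obtain ⟨C, hC, hC2, -⟩ := k1 h4
    obtain ⟨D, hD, hD2, -⟩ := k2 m2
    have qC : ∀ t, (t ∈ ({b, c, d} : Set α)) ↔ t ∈ C ∩ LS [a, b, c, d] := fun t => by rw [hC2]
    have qD : ∀ t, (t ∈ ({e, a, d} : Set α)) ↔ t ∈ D ∩ LS [c, e, a, d] := fun t => by rw [hD2]
    have c1 := qC c
    have c2 := qC d
    have c3 := qC a
    have d1 := qD c
    have d2 := qD d
    have d3 := qD a
    simp [LS, hab, hac, had] at c1 c2 c3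
    simp [LS, hce, hca, hcd] at d1 d2 d3
    exact nested hr hC hD c2 d2 c1 d1 d3 c3
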